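/- Let (X,d) be a complete and connected metric space with 0 < ℋ¹(X) < ∞, equipped with the measure ℋ¹, and suppose there is a constant C₀ > 0 such that liminf_{r→0} ℋ¹(B(x,r))/r < C₀ for every x ∈ X. If u : X → ℝ satisfies Var(u,X) < ∞, then the coarea inequality ∫*_ℝ Var(χ_{{u>t}},X) dt ≤ (3+4C₀)·Var(u,X) holds, where ∫* denotes the upper integral and χ_{{u>t}} is the characteristic function of {x ∈ X : u(x) > t}. -/

import Mathlib

open MeasureTheory Set Filter Topology ENNReal

/-- A rectifiable curve parametrized by arc length: a map defined (in effect) on `[0, len]`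
whose variation on every subinterval `[s,t] ⊆ [0,len]` equals `t - s`. -/
structure MCurve (X : Type*) [MetricSpace X] where
  len : ℝ
  len_nonneg : 0 ≤ len
  toFun : ℝ → X
  arclength : ∀ s t : ℝ, s ∈ Set.Icc 0 len → t ∈ Set.Icc 0 len → s ≤ t →
    eVariationOn toFun (Set.Icc s t) = ENNReal.ofReal (t - s)

namespace MCurve

variable {X : Type*} [MetricSpace X]

/-- The image of a curve. -/
def image (γ : MCurve X) : Set X := γ.toFun '' Set.Icc 0 γ.len

/-- A curve is simple (injective) if its parametrization is injective on `[0, len]`. -/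
def IsSimple (γ : MCurve X) : Prop := Set.InjOn γ.toFun (Set.Icc 0 γ.len)

end MCurve

/-- Pointwise variation `pV(v, X)`: supremum over finite collections of pairwise disjoint
injective arc-length parametrized curves of the sums of endpoint differences. -/
noncomputable def pVar {X : Type*} [MetricSpace X] (v : X → ℝ) : ℝ≥0∞ :=
  ⨆ (n : ℕ) (γ : Fin n → MCurve X) (_ : ∀ i, (γ i).IsSimple)
    (_ : ∀ i j, i ≠ j → Disjoint (γ i).image (γ j).image),
    ∑ i, ENNReal.ofReal |v ((γ i).toFun (γ i).len) - v ((γ i).toFun 0)|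

/-- Pointwise variation `pV_D(v, X)` with curve endpoints restricted to lie in `D`. -/
noncomputable def pVarOn {X : Type*} [MetricSpace X] (D : Set X) (v : X → ℝ) : ℝ≥0∞ :=
  ⨆ (n : ℕ) (γ : Fin n → MCurve X) (_ : ∀ i, (γ i).IsSimple)
    (_ : ∀ i j, i ≠ j → Disjoint (γ i).image (γ j).image)
    (_ : ∀ i, (γ i).toFun 0 ∈ D ∧ (γ i).toFun (γ i).len ∈ D),
    ∑ i, ENNReal.ofReal |v ((γ i).toFun (γ i).len) - v ((γ i).toFun 0)|

/-- `Var(u, X)`: infimum of `pV(v, X)` over representatives `v = u` a.e. -/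
noncomputable def VarH {X : Type*} [MetricSpace X] [MeasurableSpace X]
    (μ : Measure X) (u : X → ℝ) : ℝ≥0∞ :=
  ⨅ (v : X → ℝ) (_ : v =ᵐ[μ] u), pVar v

/-- `g` is an upper gradient of `u`: `g` is Borel and the upper gradient inequality holds
along every arc-length parametrized rectifiable curve. -/
def IsUpperGradient {X : Type*} [MetricSpace X] [MeasurableSpace X]
    (u : X → ℝ) (g : X → ℝ≥0∞) : Prop :=
  Measurable g ∧ ∀ γ : MCurve X,
    ENNReal.ofReal |u (γ.toFun γ.len) - u (γ.toFun 0)| ≤ ∫⁻ s in Set.Icc 0 γ.len, g (γ.toFun s)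

/-- The total variation `‖Du‖(X)`: infimum of `liminf ∫ gᵢ dμ` over sequences `uᵢ → u` in
`L¹(X, μ)` with upper gradients `gᵢ`. -/
noncomputable def totalVarH {X : Type*} [MetricSpace X] [MeasurableSpace X]
    (μ : Measure X) (u : X → ℝ) : ℝ≥0∞ :=
  ⨅ (ui : ℕ → X → ℝ) (gi : ℕ → X → ℝ≥0∞) (_ : ∀ i, IsUpperGradient (ui i) (gi i))
    (_ : Filter.Tendsto (fun i => ∫⁻ x, ENNReal.ofReal |ui i x - u x| ∂μ)
      Filter.atTop (nhds 0)),
    Filter.atTop.liminf (fun i => ∫⁻ x, gi i x ∂μ)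

/-- The upper integral of a function `f : ℝ → ℝ≥0∞` with respect to Lebesgue measure:
the infimum of `∫⁻ g` over measurable majorants `g` of `f`. -/
noncomputable def upperIntegral (f : ℝ → ℝ≥0∞) : ℝ≥0∞ :=
  ⨅ (g : ℝ → ℝ≥0∞) (_ : Measurable g) (_ : ∀ t, f t ≤ g t), ∫⁻ t, g t


namespace MCurve
variable {X : Type*} [MetricSpace X]

lemma edist_le (γ : MCurve X) {s t : ℝ} (hs : s ∈ Icc 0 γ.len) (ht : t ∈ Icc 0 γ.len) :
    edist (γ.toFun s) (γ.toFun t) ≤ ENNReal.ofReal |s - t| := by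
  rcases le_total s t with h | h
  · have := eVariationOn.edist_le γ.toFun (s := Icc s t) (left_mem_Icc.2 h) (right_mem_Icc.2 h)
    rw [γ.arclength s t hs ht h] at this
    rwa [abs_sub_comm, abs_of_nonneg (sub_nonneg.2 h)]
  · have := eVariationOn.edist_le γ.toFun (s := Icc t s) (right_mem_Icc.2 h) (left_mem_Icc.2 h)
    rw [γ.arclength t s ht hs h] at this
    rwa [abs_of_nonneg (sub_nonneg.2 h)]

lemma dist_le (γ : MCurve X) {s t : ℝ} (hs : s ∈ Icc 0 γ.len) (ht : t ∈ Icc 0 γ.len) :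
    dist (γ.toFun s) (γ.toFun t) ≤ |s - t| := by
  have := γ.edist_le hs ht
  rw [edist_dist] at this
  exact (ENNReal.ofReal_le_ofReal_iff (abs_nonneg _)).1 this

/-- Restriction of a curve to a subinterval. -/
def sub (γ : MCurve X) (a b : ℝ) (ha : 0 ≤ a) (hab : a ≤ b) (hb : b ≤ γ.len) : MCurve X where
  len := b - a
  len_nonneg := sub_nonneg.2 hab
  toFun := γ.toFun ∘ (fun s => a + s)
  arclength := by
    intro s t hs ht hst
    have hm : MonotoneOn (fun s : ℝ => a + s) (Icc s t) := fun x _ y _ h => by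
      simpa using h
    rw [eVariationOn.comp_eq_of_monotoneOn _ _ hm, image_const_add_Icc, γ.arclength]
    · congr 1; ring
    · exact ⟨by linarith [hs.1], by linarith [hs.2]⟩
    · exact ⟨by linarith [ht.1], by linarith [ht.2]⟩
    · linarith

lemma sub_image (γ : MCurve X) (a b : ℝ) (ha : 0 ≤ a) (hab : a ≤ b) (hb : b ≤ γ.len) :
    (γ.sub a b ha hab hb).image = γ.toFun '' Icc a b := by
  simp only [image, sub, image_comp, image_const_add_Icc]
  simp

lemma sub_simple (γ : MCurve X) (h : γ.IsSimple) (a b : ℝ) (ha : 0 ≤ a) (hab : a ≤ b)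
    (hb : b ≤ γ.len) : (γ.sub a b ha hab hb).IsSimple := by
  intro s hs t ht hst
  have hs' : s ∈ Icc 0 (b - a) := hs
  have ht' : t ∈ Icc 0 (b - a) := ht
  have := @h (a + s) ⟨by linarith [hs'.1], by linarith [hs'.2]⟩
    (a + t) ⟨by linarith [ht'.1], by linarith [ht'.2]⟩ hst
  linarith

/-- unordered restriction -/
lemma exists_sub (γ : MCurve X) (h : γ.IsSimple) (v : X → ℝ) {a b : ℝ} (ha : a ∈ Icc 0 γ.len)
    (hb : b ∈ Icc 0 γ.len) : ∃ γ' : MCurve X, γ'.IsSimple ∧ γ'.image = γ.toFun '' uIcc a b ∧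
      |v (γ'.toFun γ'.len) - v (γ'.toFun 0)| = |v (γ.toFun b) - v (γ.toFun a)| := by
  rcases le_total a b with hab | hab
  · refine ⟨γ.sub a b ha.1 hab hb.2, γ.sub_simple h _ _ _ _ _, ?_, ?_⟩
    · rw [sub_image, uIcc_of_le hab]
    · simp [sub]
  · refine ⟨γ.sub b a hb.1 hab ha.2, γ.sub_simple h _ _ _ _ _, ?_, ?_⟩
    · rw [sub_image, uIcc_of_ge hab]
    · simp [sub, abs_sub_comm]

end MCurve

section main
variable {X : Type*} [MetricSpace X]

/-- finite disjoint families of curves in `U` -/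
def Fam (U : Set X) : Type _ := {p : Σ n : ℕ, Fin n → MCurve X //
  (∀ i, (p.2 i).IsSimple) ∧ (∀ i j, i ≠ j → Disjoint (p.2 i).image (p.2 j).image) ∧
    ∀ i, (p.2 i).image ⊆ U}

instance (U : Set X) : Nonempty (Fam U) :=
  ⟨⟨⟨0, Fin.elim0⟩, fun i => i.elim0, fun i => i.elim0, fun i => i.elim0⟩⟩

/-- variation along a curve -/
noncomputable def cv (v : X → ℝ) (γ : MCurve X) : ℝ≥0∞ :=
  ENNReal.ofReal |v (γ.toFun γ.len) - v (γ.toFun 0)|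

/-- variation within `U` -/
noncomputable def pVU (U : Set X) (v : X → ℝ) : ℝ≥0∞ :=
  ⨆ p : Fam U, ∑ i, cv v (p.1.2 i)

lemma le_pVU {ι : Type*} [Fintype ι] (U : Set X) (v : X → ℝ) (γ : ι → MCurve X)
    (h1 : ∀ i, (γ i).IsSimple) (h2 : ∀ i j, i ≠ j → Disjoint (γ i).image (γ j).image)
    (h3 : ∀ i, (γ i).image ⊆ U) : ∑ i, cv v (γ i) ≤ pVU U v := by
  classical
  let e := Fintype.equivFin ι
  refine le_trans ?_ (le_iSup (fun p : Fam U => ∑ i, cv v (p.1.2 i))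
    ⟨⟨Fintype.card ι, γ ∘ e.symm⟩, fun i => h1 _, fun i j hij => h2 _ _ (by simpa using hij),
      fun i => h3 _⟩)
  exact (Equiv.sum_comp e.symm (fun i => cv v (γ i))).ge

lemma pVU_le_pVar (U : Set X) (v : X → ℝ) : pVU U v ≤ pVar v := by
  refine iSup_le fun p => ?_
  obtain ⟨⟨n, γ⟩, h1, h2, h3⟩ := p
  unfold pVar
  refine le_trans ?_ (le_iSup _ n)
  refine le_trans ?_ (le_iSup _ γ)
  refine le_trans ?_ (le_iSup _ h1)
  exact le_iSup (fun _ : ∀ i j, i ≠ j → Disjoint (γ i).image (γ j).image =>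
    ∑ i, ENNReal.ofReal |v ((γ i).toFun (γ i).len) - v ((γ i).toFun 0)|) h2

lemma pVU_mono {U W : Set X} (h : U ⊆ W) (v : X → ℝ) : pVU U v ≤ pVU W v :=
  iSup_le fun p => le_pVU _ _ _ p.2.1 p.2.2.1 fun i => (p.2.2.2 i).trans h

lemma pVU_add {U W : Set X} (h : Disjoint U W) (v : X → ℝ) :
    pVU U v + pVU W v ≤ pVU (U ∪ W) v := by
  refine ENNReal.iSup_add_iSup_le fun p q => ?_
  have := le_pVU (U ∪ W) v (Sum.elim p.1.2 q.1.2) ?_ ?_ ?_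
  · simpa using this
  · rintro (i | i)
    · exact p.2.1 i
    · exact q.2.1 i
  · rintro (i | i) (j | j) hij
    · exact p.2.2.1 i j (by simpa using hij)
    · exact h.mono (p.2.2.2 i) (q.2.2.2 j)
    · exact (h.mono (p.2.2.2 j) (q.2.2.2 i)).symm
    · exact q.2.2.1 i j (by simpa using hij)
  · rintro (i | i)
    · exact (p.2.2.2 i).trans subset_union_left
    · exact (q.2.2.2 i).trans subset_union_right

/-- local oscillation -/
noncomputable def osc (v : X → ℝ) (x : X) : ℝ≥0∞ :=
  ⨅ (r : ℝ) (_ : 0 < r), pVU (Metric.ball x r) v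

lemma sum_osc_le (v : X → ℝ) (A : Finset X) : ∑ x ∈ A, osc v x ≤ pVar v := by
  classical
  obtain ⟨r, hr, hd⟩ : ∃ r > 0, ∀ x ∈ A, ∀ y ∈ A, x ≠ y → r + r ≤ dist x y := by
    have : ∀ᶠ r : ℝ in 𝓝[>] 0, ∀ x ∈ A, ∀ y ∈ A, x ≠ y → r + r ≤ dist x y := by
      refine (Finset.eventually_all A).2 fun x _ => (Finset.eventually_all A).2 fun y _ => ?_
      by_cases hxy : x = y
      · simp [hxy]
      have : Ioo 0 (dist x y / 2) ∈ 𝓝[>] (0:ℝ) :=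
        Ioo_mem_nhdsGT (by have := dist_pos.2 hxy; positivity)
      filter_upwards [this] with r hr _
      linarith [hr.2]
    obtain ⟨r, h, hr⟩ := (this.and self_mem_nhdsWithin).exists
    exact ⟨r, hr, h⟩
  have key : ∀ B : Finset X, B ⊆ A →
      ∑ x ∈ B, pVU (Metric.ball x r) v ≤ pVU (⋃ x ∈ B, Metric.ball x r) v := by
    intro B
    induction B using Finset.induction_on with
    | empty => simp
    | insert a B ha ih =>
      intro hB
      rw [Finset.sum_insert ha, Finset.set_biUnion_insert]
      refine le_trans (add_le_add le_rfl (ih fun x hx => hB (Finset.mem_insert_of_mem hx)))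
        (pVU_add ?_ v)
      simp only [disjoint_iUnion_right]
      intro x hx
      refine Metric.ball_disjoint_ball (hd _ (hB (Finset.mem_insert_self _ _)) _
        (hB (Finset.mem_insert_of_mem hx)) ?_)
      rintro rfl; exact ha hx
  refine le_trans (Finset.sum_le_sum fun x _ => ?_) ((key A subset_rfl).trans (pVU_le_pVar _ _))
  exact iInf₂_le r hr

lemma cross_mem (v : X → ℝ) (γ : MCurve X) (hγ : γ.IsSimple) {σ τ : ℝ} (hσ : σ ∈ Icc 0 γ.len)
    (h1 : ∀ ε > 0, ∃ r ∈ Icc 0 γ.len, |r - σ| < ε ∧ τ ≤ v (γ.toFun r))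
    (h2 : ∀ ε > 0, ∃ r ∈ Icc 0 γ.len, |r - σ| < ε ∧ v (γ.toFun r) ≤ τ) :
    edist τ (v (γ.toFun σ)) ≤ osc v (γ.toFun σ) := by
  refine le_iInf₂ fun ε hε => ?_
  obtain ⟨r, hr, hrσ, hle⟩ : ∃ r ∈ Icc 0 γ.len, |r - σ| < ε ∧
      |τ - v (γ.toFun σ)| ≤ |v (γ.toFun r) - v (γ.toFun σ)| := by
    rcases le_total τ (v (γ.toFun σ)) with h | h
    · obtain ⟨r, hr, a, b⟩ := h2 ε hε
      refine ⟨r, hr, a, ?_⟩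
      rw [abs_of_nonpos (by linarith), abs_of_nonpos (by linarith)]; linarith
    · obtain ⟨r, hr, a, b⟩ := h1 ε hε
      refine ⟨r, hr, a, ?_⟩
      rw [abs_of_nonneg (by linarith), abs_of_nonneg (by linarith)]; linarith
  obtain ⟨γ', hs, him, hv⟩ := γ.exists_sub hγ v hσ hr
  have := le_pVU (ι := Unit) (Metric.ball (γ.toFun σ) ε) v (fun _ => γ') (fun _ => hs)
    (fun i j h => (h rfl).elim) ?_
  · refine le_trans ?_ this
    simp only [Finset.univ_unique, Finset.sum_const, Finset.card_singleton, one_smul, cv, hv]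
    rw [edist_dist, Real.dist_eq]
    exact ENNReal.ofReal_le_ofReal hle
  · intro _
    rw [him]
    rintro _ ⟨s, hs, rfl⟩
    have hs' : s ∈ Icc 0 γ.len := (ordConnected_Icc.uIcc_subset hσ hr) hs
    refine lt_of_le_of_lt (γ.dist_le hs' hσ) (lt_of_le_of_lt ?_ hrσ)
    exact abs_sub_left_of_mem_uIcc hs

lemma exit_aux (f : ℝ → ℝ) {a b t τ τ' : ℝ} (hab : a ≤ b) (ht : f a = t) (h1 : τ' < t)
    (h2 : t < τ) (hb : τ ≤ f b)
    (good : ∀ z, z = τ ∨ z = τ' → ∀ σ ∈ Icc a b,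
      (∀ ε > 0, ∃ r ∈ Icc a b, |r - σ| < ε ∧ z ≤ f r) →
      (∀ ε > 0, ∃ r ∈ Icc a b, |r - σ| < ε ∧ f r ≤ z) → f σ = z) :
    ∃ σ ∈ Icc a b, (f σ = τ ∨ f σ = τ') ∧ ∀ r ∈ Icc a σ, f r ∈ Icc τ' τ := by
  set E : Set ℝ := {r | r ∈ Icc a b ∧ (τ ≤ f r ∨ f r ≤ τ')} with hE
  have hbE : b ∈ E := ⟨right_mem_Icc.2 hab, Or.inl hb⟩
  have hbd : BddBelow E := ⟨a, fun r hr => hr.1.1⟩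
  set σ := sInf E with hσ
  have haσ : a ≤ σ := le_csInf ⟨b, hbE⟩ fun r hr => hr.1.1
  have hσb : σ ≤ b := csInf_le hbd hbE
  have hlow : ∀ r ∈ Ico a σ, τ' < f r ∧ f r < τ := by
    intro r hr
    have : r ∉ E := fun h => absurd (csInf_le hbd h) (not_le.2 hr.2)
    by_contra hc
    refine this ⟨⟨hr.1, by linarith [hr.2]⟩, ?_⟩
    by_contra h'
    push Not at h'
    exact hc ⟨h'.2, h'.1⟩
  have hnear : ∀ ε > 0, ∃ r ∈ Icc a b, |r - σ| < ε ∧ (τ' < f r ∧ f r < τ) := by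
    intro ε hε
    rcases haσ.eq_or_lt with h | h
    · exact ⟨a, left_mem_Icc.2 hab, by simpa [← h] using hε, by rw [ht]; exact ⟨h1, h2⟩⟩
    · refine ⟨max a (σ - ε/2), ⟨le_max_left _ _, max_le hab (by linarith)⟩, ?_, ?_⟩
      · rw [abs_lt]
        constructor
        · linarith [le_max_right a (σ - ε/2)]
        · have : max a (σ - ε/2) ≤ σ := max_le haσ (by linarith)
          linarith
      · exact hlow _ ⟨le_max_left _ _, max_lt h (by linarith)⟩
  have hfar : (∀ ε > 0, ∃ r ∈ Icc a b, |r - σ| < ε ∧ τ ≤ f r) ∨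
      (∀ ε > 0, ∃ r ∈ Icc a b, |r - σ| < ε ∧ f r ≤ τ') := by
    by_contra hc
    push Not at hc
    obtain ⟨⟨e1, he1, h1'⟩, e2, he2, h2'⟩ := hc
    obtain ⟨r, hrE, hr⟩ := exists_lt_of_csInf_lt ⟨b, hbE⟩
      (show sInf E < σ + min e1 e2 by have := lt_min he1 he2; linarith)
    have hσr : σ ≤ r := csInf_le hbd hrE
    have habs : |r - σ| < min e1 e2 := by rw [abs_of_nonneg (by linarith)]; linarith
    rcases hrE.2 with h | h
    · exact absurd h (not_le.2 (h1' r hrE.1 (habs.trans_le (min_le_left _ _))))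
    · exact absurd h (not_le.2 (h2' r hrE.1 (habs.trans_le (min_le_right _ _))))
  have hσm : σ ∈ Icc a b := ⟨haσ, hσb⟩
  have hval : f σ = τ ∨ f σ = τ' := by
    rcases hfar with h | h
    · left
      refine good τ (Or.inl rfl) σ hσm h fun ε hε => ?_
      obtain ⟨r, a, b, c⟩ := hnear ε hε
      exact ⟨r, a, b, c.2.le⟩
    · right
      refine good τ' (Or.inr rfl) σ hσm (fun ε hε => ?_) h
      obtain ⟨r, a, b, c⟩ := hnear ε hε
      exact ⟨r, a, b, c.1.le⟩
  refine ⟨σ, hσm, hval, fun r hr => ?_⟩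
  rcases hr.2.eq_or_lt with h | h
  · rw [h]
    rcases hval with h | h <;> rw [h]
    · exact ⟨by linarith, le_rfl⟩
    · exact ⟨le_rfl, by linarith⟩
  · have := hlow r ⟨hr.1, h⟩
    exact ⟨this.1.le, this.2.le⟩

lemma exit_aux' (f : ℝ → ℝ) {a b t τ τ' : ℝ} (ht : f a = t) (h1 : τ' < t)
    (h2 : t < τ) (hb : τ ≤ f b)
    (good : ∀ z, z = τ ∨ z = τ' → ∀ σ ∈ uIcc a b,
      (∀ ε > 0, ∃ r ∈ uIcc a b, |r - σ| < ε ∧ z ≤ f r) →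
      (∀ ε > 0, ∃ r ∈ uIcc a b, |r - σ| < ε ∧ f r ≤ z) → f σ = z) :
    ∃ σ ∈ uIcc a b, (f σ = τ ∨ f σ = τ') ∧ ∀ r ∈ uIcc a σ, f r ∈ Icc τ' τ := by
  rcases le_total a b with hab | hab
  · rw [uIcc_of_le hab] at *
    obtain ⟨σ, h, h', h''⟩ := exit_aux f hab ht h1 h2 hb good
    exact ⟨σ, h, h', by rw [uIcc_of_le h.1]; exact h''⟩
  · rw [uIcc_of_ge hab] at *
    have hn : ∀ r, r ∈ Icc (-a) (-b) → -r ∈ Icc b a := fun r hr =>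
      ⟨by linarith [hr.2], by linarith [hr.1]⟩
    have hn' : ∀ r, r ∈ Icc b a → -r ∈ Icc (-a) (-b) := fun r hr =>
      ⟨by linarith [hr.2], by linarith [hr.1]⟩
    have habs : ∀ r σ : ℝ, |-r - -σ| = |r - σ| := fun r σ => by
      rw [← abs_neg]; congr 1; ring
    obtain ⟨σ, h, h', h''⟩ := exit_aux (fun r => f (-r)) (a := -a) (b := -b) (t := t) (τ := τ)
      (τ' := τ') (by linarith) (by simpa using ht) h1 h2 (by simpa using hb) (by
        intro z hz σ hσ H1 H2
        refine good z hz (-σ) (hn _ hσ) (fun ε hε => ?_) (fun ε hε => ?_)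
        · obtain ⟨r, hr, e, e'⟩ := H1 ε hε
          exact ⟨-r, hn _ hr, by rwa [habs], e'⟩
        · obtain ⟨r, hr, e, e'⟩ := H2 ε hε
          exact ⟨-r, hn _ hr, by rwa [habs], e'⟩)
    refine ⟨-σ, hn _ h, h', fun r hr => ?_⟩
    rw [uIcc_of_ge (hn _ h).2] at hr
    have := h'' (-r) ⟨by linarith [hr.2], by linarith [hr.1]⟩
    simpa using this

lemma local_piece (v : X → ℝ) (γ : MCurve X) (hγ : γ.IsSimple) {s t : ℝ} (hs : s ∈ Icc 0 γ.len)
    (ht : v (γ.toFun s) = t) (hacc : ∀ ε > 0, ∃ r ∈ Icc 0 γ.len, |r - s| < ε ∧ t < v (γ.toFun r))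
    (S : Set X) (hS : S.Finite) (hsS : γ.toFun s ∉ S) :
    ∃ δ₀ > 0, ∀ δ > 0, δ < δ₀ → ∀ τ ∈ Ioo (t + δ/2) (t + δ), ∀ τ' ∈ Ioo (t - δ) (t - δ/2),
      (∀ x ∉ S, edist τ (v x) ≤ osc v x → v x = τ) →
      (∀ x ∉ S, edist τ' (v x) ≤ osc v x → v x = τ') →
      ∃ γ' : MCurve X, γ'.IsSimple ∧ γ'.image ⊆ γ.image ∧ γ'.image ⊆ v ⁻¹' (Ico (t - δ) (t + δ)) ∧
        ENNReal.ofReal (δ/2) ≤ cv v γ' := by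
  obtain ⟨η, hη, hηS⟩ : ∃ η > 0, ∀ r ∈ Icc 0 γ.len, |r - s| < η → γ.toFun r ∉ S := by
    obtain ⟨η, hη, h⟩ := Metric.isOpen_iff.1 hS.isClosed.isOpen_compl _ hsS
    exact ⟨η, hη, fun r hr hrs => h ((γ.dist_le hr hs).trans_lt hrs)⟩
  obtain ⟨s', hs', hss', hgt⟩ := hacc η hη
  refine ⟨v (γ.toFun s') - t, sub_pos.2 hgt, ?_⟩
  intro δ hδ hδ' τ hτ τ' hτ' g1 g2
  have hsub : uIcc s s' ⊆ Icc 0 γ.len := ordConnected_Icc.uIcc_subset hs hs'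
  have hav : ∀ r ∈ uIcc s s', γ.toFun r ∉ S := fun r hr =>
    hηS r (hsub hr) ((abs_sub_left_of_mem_uIcc hr).trans_lt hss')
  obtain ⟨σ, hσ, hv, him⟩ := exit_aux' (fun r => v (γ.toFun r)) (a := s) (b := s') (t := t)
    (τ := τ) (τ' := τ') ht (by linarith [hτ'.2]) (by linarith [hτ.1]) (by linarith [hτ.2]) (by
      intro z hz σ hσ H1 H2
      have hm := cross_mem v γ hγ (σ := σ) (τ := z) (hsub hσ)
        (fun ε hε => by
          obtain ⟨r, hr, h⟩ := H1 ε hε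
          exact ⟨r, hsub hr, h⟩)
        (fun ε hε => by
          obtain ⟨r, hr, h⟩ := H2 ε hε
          exact ⟨r, hsub hr, h⟩)
      rcases hz with rfl | rfl
      · exact g1 _ (hav σ hσ) hm
      · exact g2 _ (hav σ hσ) hm)
  obtain ⟨γ', h1, h2, h3⟩ := γ.exists_sub hγ v hs (hsub hσ)
  refine ⟨γ', h1, ?_, ?_, ?_⟩
  · rw [h2]
    exact image_mono ((uIcc_subset_uIcc_left hσ).trans hsub)
  · rw [h2]
    rintro _ ⟨r, hr, rfl⟩
    have := him r hr
    exact ⟨by linarith [this.1, hτ'.1], by linarith [this.2, hτ.2]⟩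
  · rw [cv, h3, ht]
    refine ENNReal.ofReal_le_ofReal ?_
    rcases hv with h | h <;> rw [h]
    · exact le_trans (by linarith [hτ.1]) (le_abs_self _)
    · exact le_trans (by linarith [hτ'.2]) (neg_le_abs _)

lemma exists_cross (v : X → ℝ) (γ : MCurve X) {t : ℝ}
    (h : (t < v (γ.toFun 0) ∧ v (γ.toFun γ.len) ≤ t) ∨
      (t < v (γ.toFun γ.len) ∧ v (γ.toFun 0) ≤ t)) :
    ∃ s ∈ Icc 0 γ.len, (∀ ε > 0, ∃ r ∈ Icc 0 γ.len, |r - s| < ε ∧ t < v (γ.toFun r)) ∧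
      (∀ ε > 0, ∃ r ∈ Icc 0 γ.len, |r - s| < ε ∧ v (γ.toFun r) ≤ t) := by
  set A := {r ∈ Icc 0 γ.len | t < v (γ.toFun r)}
  set B := {r ∈ Icc 0 γ.len | v (γ.toFun r) ≤ t}
  have h0 : (0:ℝ) ∈ Icc 0 γ.len := left_mem_Icc.2 γ.len_nonneg
  have hL : γ.len ∈ Icc 0 γ.len := right_mem_Icc.2 γ.len_nonneg
  have hAB : (Icc 0 γ.len ∩ closure A).Nonempty ∧ (Icc 0 γ.len ∩ closure B).Nonempty := by
    rcases h with h | h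
    · exact ⟨⟨0, h0, subset_closure ⟨h0, h.1⟩⟩, ⟨γ.len, hL, subset_closure ⟨hL, h.2⟩⟩⟩
    · exact ⟨⟨γ.len, hL, subset_closure ⟨hL, h.1⟩⟩, ⟨0, h0, subset_closure ⟨h0, h.2⟩⟩⟩
  obtain ⟨s, hs, hsA, hsB⟩ := isPreconnected_closed_iff.1 (isPreconnected_Icc (a := (0:ℝ))
    (b := γ.len)) (closure A) (closure B) isClosed_closure isClosed_closure (by
      intro r hr
      rcases lt_or_ge t (v (γ.toFun r)) with h | h
      · exact Or.inl (subset_closure ⟨hr, h⟩)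
      · exact Or.inr (subset_closure ⟨hr, h⟩)) hAB.1 hAB.2
  rw [Metric.mem_closure_iff] at hsA hsB
  refine ⟨s, hs, fun ε hε => ?_, fun ε hε => ?_⟩
  · obtain ⟨r, hr, hd⟩ := hsA ε hε
    exact ⟨r, hr.1, by rwa [abs_sub_comm], hr.2⟩
  · obtain ⟨r, hr, hd⟩ := hsB ε hε
    exact ⟨r, hr.1, by rwa [abs_sub_comm], hr.2⟩

end main

lemma density_aux {U : Set ℝ} (hU : MeasurableSet U) : ∀ᵐ t : ℝ, t ∉ U →
    ∀ᶠ δ in 𝓝[>] (0:ℝ), (∃ τ ∈ Ioo (t + δ/2) (t + δ), τ ∉ U) ∧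
      ∃ τ ∈ Ioo (t - δ) (t - δ/2), τ ∉ U := by
  filter_upwards [Besicovitch.ae_tendsto_measure_inter_div_of_measurableSet volume hU] with t ht htU
  rw [indicator_of_notMem htU] at ht
  have hev := ht.eventually (gt_mem_nhds (show (0:ℝ≥0∞) < ENNReal.ofReal (1/4) by simp))
  filter_upwards [hev, self_mem_nhdsWithin] with δ hδ hδ0
  have hδ0 : 0 < δ := hδ0
  have key : ∀ a : ℝ, Ioo a (a + δ/2) ⊆ Metric.closedBall t δ → ∃ τ ∈ Ioo a (a + δ/2), τ ∉ U := by
    intro a ha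
    by_contra hc
    push Not at hc
    have h1 : volume (Ioo a (a + δ/2)) ≤ volume (U ∩ Metric.closedBall t δ) :=
      measure_mono fun x hx => ⟨hc x hx, ha hx⟩
    rw [Real.volume_Ioo] at h1
    rw [Real.volume_closedBall] at hδ
    have h2 : ENNReal.ofReal (1/4) ≤ volume (U ∩ Metric.closedBall t δ) / ENNReal.ofReal (2 * δ) := by
      rw [ENNReal.le_div_iff_mul_le (Or.inl (by simpa using hδ0)) (Or.inl ENNReal.ofReal_ne_top),
        ← ENNReal.ofReal_mul (by norm_num)]
      refine le_trans (ENNReal.ofReal_le_ofReal ?_) h1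
      linarith
    exact absurd hδ (not_lt.2 h2)
  constructor
  · have := key (t + δ/2) (fun x hx => by
      rw [Real.closedBall_eq_Icc]; exact ⟨by linarith [hx.1], by linarith [hx.2]⟩)
    rwa [show t + δ/2 + δ/2 = t + δ by ring] at this
  · have := key (t - δ) (fun x hx => by
      rw [Real.closedBall_eq_Icc]; exact ⟨by linarith [hx.1], by linarith [hx.2]⟩)
    rwa [show t - δ + δ/2 = t - δ/2 by ring] at this

lemma deriv_aux {F : ℝ → ℝ} {d t c : ℝ} (h : HasDerivAt F d t)
    (hc : ∀ᶠ δ in 𝓝[>] (0:ℝ), c * δ ≤ F (t + δ) - F (t - δ)) : c ≤ 2 * d := by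
  have h1 : HasDerivAt (fun δ => F (t + δ) - F (t - δ)) (d * 1 - d * (-1)) 0 := by
    have a1 : HasDerivAt (fun δ : ℝ => t + δ) 1 0 := (hasDerivAt_id 0).const_add t
    have a2 : HasDerivAt (fun δ : ℝ => t - δ) (-1) 0 := (hasDerivAt_id 0).const_sub t
    refine HasDerivAt.sub ?_ ?_
    · exact HasDerivAt.comp (0:ℝ) (h₂ := F) (by simpa using h) a1
    · exact HasDerivAt.comp (0:ℝ) (h₂ := F) (by simpa using h) a2
  have h2 := h1.tendsto_slope.mono_left (nhdsWithin_mono (0:ℝ)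
    (fun x (hx : x ∈ Ioi (0:ℝ)) => ne_of_gt hx))
  have h3 : c ≤ d * 1 - d * (-1) := by
    refine ge_of_tendsto h2 ?_
    filter_upwards [hc, self_mem_nhdsWithin] with δ hδ hδ0
    have hδ0 : 0 < δ := hδ0
    rw [slope_def_field]
    simp only [add_zero, sub_zero, sub_self]
    rwa [le_div_iff₀ hδ0]
  linarith

lemma total_aux {F : ℝ → ℝ} (hF : Monotone F) {V : ℝ} (h0 : ∀ t, 0 ≤ F t) (hV : ∀ t, F t ≤ V) :
    ∫⁻ t, hF.stieltjesFunction.measure.rnDeriv volume t ≤ ENNReal.ofReal V := by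
  refine Measure.lintegral_rnDeriv_le.trans ?_
  have hun : (univ : Set ℝ) = ⋃ n : ℕ, Ioc (-(n:ℝ)) n := by
    refine (eq_univ_of_forall fun x => ?_).symm
    obtain ⟨n, hn⟩ := exists_nat_gt |x|
    exact mem_iUnion.2 ⟨n, by linarith [neg_abs_le x], by linarith [le_abs_self x]⟩
  have hm : Monotone fun n : ℕ => Ioc (-(n:ℝ)) n := by
    intro m n hmn
    have : (m:ℝ) ≤ n := by exact_mod_cast hmn
    exact Ioc_subset_Ioc (by linarith) this
  rw [hun, hm.measure_iUnion]
  refine iSup_le fun n => ?_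
  rw [StieltjesFunction.measure_Ioc]
  refine ENNReal.ofReal_le_ofReal ?_
  rw [hF.stieltjesFunction_eq, hF.stieltjesFunction_eq]
  have e1 : Function.rightLim F n ≤ F (n + 1) := hF.rightLim_le (by linarith)
  have e2 : F (-n) ≤ Function.rightLim F (-n) := hF.le_rightLim le_rfl
  linarith [hV (n + 1), h0 (-n)]

lemma C0_ge {X : Type*} [MetricSpace X] [ConnectedSpace X] [MeasurableSpace X] [BorelSpace X]
    (h0 : 0 < μH[1] (Set.univ : Set X)) (C₀ : ℝ)
    (hdens : ∀ x : X, Filter.liminf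
      (fun r : ℝ => μH[1] (Metric.ball x r) / ENNReal.ofReal r) (𝓝[>] 0)
      < ENNReal.ofReal C₀) : 1 ≤ C₀ := by
  have hnt : Nontrivial X := by
    by_contra hc
    rw [not_nontrivial_iff_subsingleton] at hc
    have : (Set.univ : Set X).Subsingleton := subsingleton_univ
    have hna : NullSingletonClass (μH[1] : Measure X) :=
      Measure.nullSingletonClass_hausdorff X one_pos
    exact h0.ne' (this.measure_zero _)
  obtain ⟨x, y, hxy⟩ := exists_pair_ne X
  have hle : (1:ℝ≥0∞) ≤ Filter.liminf
      (fun r : ℝ => μH[1] (Metric.ball x r) / ENNReal.ofReal r) (𝓝[>] 0) := by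
    refine le_liminf_of_le (by isBoundedDefault) ?_
    filter_upwards [Ioo_mem_nhdsGT (dist_pos.2 hxy.symm)] with r hr
    rw [ENNReal.le_div_iff_mul_le (Or.inl (by simpa using hr.1)) (Or.inl ENNReal.ofReal_ne_top),
      one_mul]
    have hl : LipschitzWith 1 (fun z : X => dist z x) := LipschitzWith.dist_left x
    have := hl.hausdorffMeasure_image_le (d := 1) zero_le_one (Metric.ball x r)
    simp only [ENNReal.coe_one, ENNReal.one_rpow, one_mul] at this
    refine le_trans ?_ this
    rw [hausdorffMeasure_real]
    have hsub : Ico 0 r ⊆ (fun z : X => dist z x) '' Metric.ball x r := by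
      intro s hs
      obtain ⟨z, hz⟩ := mem_range_of_exists_le_of_exists_ge (f := fun z : X => dist z x)
        (c := s) (by fun_prop) ⟨x, by simpa using hs.1⟩ ⟨y, by linarith [hs.2, hr.2]⟩
      exact ⟨z, by simp only at hz; simpa [hz] using hs.2, hz⟩
    calc ENNReal.ofReal r = volume (Ico 0 r) := by simp
      _ ≤ _ := measure_mono hsub
  have := hle.trans_lt (hdens x)
  rw [ENNReal.one_lt_ofReal] at this
  exact this.le

section final
variable {X : Type*} [MetricSpace X]

lemma nonjump_count (v : X → ℝ) (hV : pVar v ≠ ⊤) (S : Set X) (hS : S.Finite) {t d : ℝ}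
    (hF : HasDerivAt (fun t => (pVU (v ⁻¹' Iio t) v).toReal) d t)
    (hgood : ∀ᶠ δ in 𝓝[>] (0:ℝ),
      (∃ τ ∈ Ioo (t + δ/2) (t + δ), ∀ x ∉ S, edist τ (v x) ≤ osc v x → v x = τ) ∧
      ∃ τ ∈ Ioo (t - δ) (t - δ/2), ∀ x ∉ S, edist τ (v x) ≤ osc v x → v x = τ)
    {α : Type*} [Fintype α] (γ : α → MCurve X) (h1 : ∀ i, (γ i).IsSimple)
    (h2 : ∀ i j, i ≠ j → Disjoint (γ i).image (γ j).image) (s : α → ℝ)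
    (hs : ∀ i, s i ∈ Icc 0 (γ i).len) (ht : ∀ i, v ((γ i).toFun (s i)) = t)
    (hacc : ∀ i, ∀ ε > 0, ∃ r ∈ Icc 0 (γ i).len, |r - s i| < ε ∧ t < v ((γ i).toFun r))
    (hsS : ∀ i, (γ i).toFun (s i) ∉ S) : (Fintype.card α : ℝ) ≤ 4 * d := by
  have hfin : ∀ U : Set X, pVU U v ≠ ⊤ := fun U => ne_top_of_le_ne_top hV (pVU_le_pVar U v)
  choose δ₀ hδ₀ hloc using fun i =>
    local_piece v (γ i) (h1 i) (hs i) (ht i) (hacc i) S hS (hsS i)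
  have hsm : ∀ᶠ δ in 𝓝[>] (0:ℝ), ∀ i, δ < δ₀ i :=
    eventually_all.2 fun i => by
      filter_upwards [Ioo_mem_nhdsGT (hδ₀ i)] with δ hδ using hδ.2
  have := deriv_aux (c := (Fintype.card α : ℝ) / 2) hF (by
    filter_upwards [hgood, hsm, self_mem_nhdsWithin] with δ hg hδ hδ0
    have hδ0 : 0 < δ := hδ0
    obtain ⟨⟨τ, hτ, hτg⟩, τ', hτ', hτg'⟩ := hg
    choose γ' c1 c2 c3 c4 using fun i => hloc i δ hδ0 (hδ i) τ hτ τ' hτ' hτg hτg'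
    have e1 := le_pVU (v ⁻¹' Ico (t - δ) (t + δ)) v γ' c1
      (fun i j hij => (h2 i j hij).mono (c2 i) (c2 j)) c3
    have e2 : (Fintype.card α : ℝ≥0∞) * ENNReal.ofReal (δ/2) ≤ ∑ i, cv v (γ' i) := by
      have : ∑ _i : α, ENNReal.ofReal (δ/2) ≤ ∑ i, cv v (γ' i) :=
        Finset.sum_le_sum fun i _ => c4 i
      simpa using this
    have e3 : pVU (v ⁻¹' Iio (t - δ)) v + pVU (v ⁻¹' Ico (t - δ) (t + δ)) v
        ≤ pVU (v ⁻¹' Iio (t + δ)) v := by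
      refine (pVU_add ?_ v).trans (pVU_mono ?_ v)
      · refine Disjoint.preimage _ ?_
        rw [Set.disjoint_left]
        intro x hx hx'
        exact absurd hx'.1 (not_le.2 hx)
      · rintro x (hx | hx)
        · have : v x < t - δ := hx
          show v x < t + δ
          linarith
        · exact hx.2
    have e4 := ENNReal.toReal_mono (hfin _) ((add_le_add le_rfl (e2.trans e1)).trans e3)
    rw [ENNReal.toReal_add (hfin _) (by finiteness), ENNReal.toReal_mul,
      ENNReal.toReal_ofReal (by positivity), ENNReal.toReal_natCast] at e4
    linarith)
  linarith

lemma main_v (v : X → ℝ) (hV : pVar v ≠ ⊤) : ∃ G : ℝ → ℝ≥0∞, Measurable G ∧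
    (∀ t, pVar (Set.indicator {x : X | t < v x} (fun _ => (1 : ℝ))) ≤ G t) ∧
    ∫⁻ t, G t ≤ 6 * pVar v := by
  classical
  have hfin : ∀ U : Set X, pVU U v ≠ ⊤ := fun U => ne_top_of_le_ne_top hV (pVU_le_pVar U v)
  have hosc : ∑' x, osc v x ≤ pVar v := by
    rw [ENNReal.tsum_eq_iSup_sum]
    exact iSup_le fun A => sum_osc_le v A
  set J : Set X := Function.support (osc v) with hJ
  have hJc : Countable J :=
    (Summable.countable_support_ennreal (ne_top_of_le_ne_top hV hosc)).to_subtype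
  let I : J → Set ℝ := fun x => Metric.closedEBall (v x) (osc v x)
  have hImeas : ∀ x, MeasurableSet (I x) := fun x => Metric.isClosed_closedEBall.measurableSet
  have hIsum : ∑' x, volume (I x) ≤ 2 * pVar v := by
    simp only [I, Real.volume_closedEBall]
    rw [ENNReal.tsum_mul_left]
    gcongr
    exact (ENNReal.tsum_comp_le_tsum_of_injective Subtype.val_injective (osc v)).trans hosc
  let h : ℝ → ℝ≥0∞ := fun t => ∑' x : J, (I x).indicator 1 t
  have hhm : Measurable h :=
    Measurable.ennreal_tsum fun x => measurable_one.indicator (hImeas x)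
  have hhint : ∫⁻ t, h t ≤ 2 * pVar v := by
    simp only [h]
    rw [lintegral_tsum fun x => (measurable_one.indicator (hImeas x)).aemeasurable]
    simpa [lintegral_indicator_one (hImeas _)] using hIsum
  have hF : Monotone (fun t => (pVU (v ⁻¹' Iio t) v).toReal) := by
    intro a b hab
    exact ENNReal.toReal_mono (hfin _) (pVU_mono (preimage_mono (Iio_subset_Iio hab)) v)
  let g : ℝ → ℝ≥0∞ := hF.stieltjesFunction.measure.rnDeriv volume
  have hgm : Measurable g := Measure.measurable_rnDeriv _ _
  have hgint : ∫⁻ t, g t ≤ pVar v := by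
    refine (total_aux hF (V := (pVar v).toReal) (fun t => ENNReal.toReal_nonneg)
      (fun t => ENNReal.toReal_mono hV (pVU_le_pVar _ _))).trans ?_
    rw [ENNReal.ofReal_toReal hV]
  have hae : ∀ᵐ t : ℝ, pVar (Set.indicator {x : X | t < v x} (fun _ => (1 : ℝ)))
      ≤ h t + 4 * g t := by
    have hIs : ∑' x, volume (I x) ≠ ⊤ := ne_top_of_le_ne_top (by finiteness) hIsum
    have A1 := ae_finite_setOfPred_mem hIs
    have A2 : ∀ᵐ t : ℝ, ∀ S : Finset J, t ∉ (⋃ x ∈ {x : J | x ∉ S}, I x) →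
        ∀ᶠ δ in 𝓝[>] (0:ℝ), (∃ τ ∈ Ioo (t + δ/2) (t + δ), τ ∉ (⋃ x ∈ {x : J | x ∉ S}, I x)) ∧
        ∃ τ ∈ Ioo (t - δ) (t - δ/2), τ ∉ (⋃ x ∈ {x : J | x ∉ S}, I x) :=
      ae_all_iff.2 fun S => density_aux
        (MeasurableSet.biUnion (to_countable _) fun x _ => hImeas x)
    filter_upwards [A1, A2, hF.ae_hasDerivAt] with t hfinS hdens hder
    have hfinS : {x : J | t ∈ I x}.Finite := hfinS
    set S0 : Finset J := hfinS.toFinset with hS0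
    have hd := hdens S0 (by
      simp only [mem_iUnion, not_exists]
      intro x hx hx'
      exact hx (by simpa [hS0] using hx'))
    have hgood : ∀ τ, τ ∉ (⋃ x ∈ {x : J | x ∉ S0}, I x) →
        ∀ x ∉ (Subtype.val '' (S0 : Set J)), edist τ (v x) ≤ osc v x → v x = τ := by
      intro τ hτ x hx hle
      by_cases h0 : osc v x = 0
      · rw [h0] at hle
        exact (edist_le_zero.1 hle).symm
      · exfalso
        refine hτ (mem_iUnion₂.2 ⟨⟨x, h0⟩, fun hm => hx ⟨⟨x, h0⟩, hm, rfl⟩, hle⟩)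
    refine iSup_le fun n => iSup_le fun γ => iSup_le fun h1 => iSup_le fun h2 => ?_
    let cr : Fin n → Prop := fun i =>
      (t < v ((γ i).toFun 0) ∧ v ((γ i).toFun (γ i).len) ≤ t) ∨
      (t < v ((γ i).toFun (γ i).len) ∧ v ((γ i).toFun 0) ≤ t)
    have hsum : ∑ i, ENNReal.ofReal |Set.indicator {x : X | t < v x} (fun _ => (1 : ℝ))
        ((γ i).toFun (γ i).len) - Set.indicator {x : X | t < v x} (fun _ => (1 : ℝ))
        ((γ i).toFun 0)| ≤ (Fintype.card {i // cr i} : ℝ≥0∞) := by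
      rw [Fintype.card_subtype, ← Finset.sum_boole]
      refine Finset.sum_le_sum fun i _ => ?_
      simp only [Set.indicator_apply, mem_setOf_eq, cr]
      by_cases c1 : t < v ((γ i).toFun 0) <;> by_cases c2 : t < v ((γ i).toFun (γ i).len) <;>
        simp [c1, c2, not_lt.1, le_of_not_gt]
    refine hsum.trans ?_
    choose s hs hsA hsB using fun i : {i // cr i} => exists_cross v (γ i) i.2
    have hmem : ∀ i : {i // cr i}, edist t (v ((γ i).toFun (s i))) ≤ osc v ((γ i).toFun (s i)) := by
      intro i
      refine cross_mem v _ (h1 _) (hs i) (fun ε hε => ?_) (hsB i)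
      obtain ⟨r, a, b, c⟩ := hsA i ε hε
      exact ⟨r, a, b, c.le⟩
    let pt : {i // cr i} → X := fun i => (γ i).toFun (s i)
    have hinj : Function.Injective pt := by
      intro i j hij
      by_contra hne
      have hd := h2 i j (fun h => hne (Subtype.ext h))
      refine Set.disjoint_left.1 hd ⟨s i, hs i, rfl⟩ ?_
      show pt i ∈ _
      rw [hij]
      exact ⟨s j, hs j, rfl⟩
    have hcard : Fintype.card {i // cr i} = Fintype.card {i : {i // cr i} // pt i ∈ J} +
        Fintype.card {i : {i // cr i} // ¬ pt i ∈ J} := by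
      have := Fintype.card_subtype_compl (fun i : {i // cr i} => pt i ∈ J)
      have := Fintype.card_subtype_le (fun i : {i // cr i} => pt i ∈ J)
      omega
    rw [hcard, Nat.cast_add]
    refine add_le_add ?_ ?_
    · have := ENNReal.tsum_comp_le_tsum_of_injective
        (f := fun i : {i : {i // cr i} // pt i ∈ J} => (⟨pt i, i.2⟩ : J))
        (fun i j hij => Subtype.ext (hinj (congrArg Subtype.val hij)))
        (fun x : J => (I x).indicator (1 : ℝ → ℝ≥0∞) t)
      refine le_trans ?_ this
      have hone : ∀ i : {i : {i // cr i} // pt i ∈ J},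
          (I ⟨pt i, i.2⟩).indicator (1 : ℝ → ℝ≥0∞) t = 1 := fun i => by
        rw [indicator_of_mem (show t ∈ I ⟨pt i, i.2⟩ from hmem i)]; rfl
      rw [tsum_fintype]
      simp [hone]
    · have hz : ∀ i : {i : {i // cr i} // ¬ pt i ∈ J}, osc v (pt i) = 0 := fun i => by
        simpa [hJ] using i.2
      have := nonjump_count v hV (Subtype.val '' (S0 : Set J)) (S0.finite_toSet.image _)
        hder (by
          filter_upwards [hd] with δ hδ
          obtain ⟨⟨τ, a, b⟩, τ', a', b'⟩ := hδ
          exact ⟨⟨τ, a, hgood τ b⟩, τ', a', hgood τ' b'⟩)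
        (fun i : {i : {i // cr i} // ¬ pt i ∈ J} => γ i) (fun i => h1 _)
        (fun i j hij => h2 _ _ fun h => hij (Subtype.ext (Subtype.ext h)))
        (fun i => s i) (fun i => hs i)
        (fun i => by
          have := hmem i
          rw [show osc v _ = 0 from hz i] at this
          exact (edist_le_zero.1 this).symm)
        (fun i => hsA i)
        (fun i => by
          rintro ⟨x, _, hx⟩
          exact i.2 (by show pt i ∈ J; rw [← show x.1 = pt i from hx]; exact x.2))
      calc (Fintype.card {i : {i // cr i} // ¬ pt i ∈ J} : ℝ≥0∞)
          = ENNReal.ofReal (Fintype.card {i : {i // cr i} // ¬ pt i ∈ J} : ℝ) := by simp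
        _ ≤ ENNReal.ofReal (4 * (g t).toReal) := ENNReal.ofReal_le_ofReal this
        _ = 4 * ENNReal.ofReal (g t).toReal := by
          rw [ENNReal.ofReal_mul (by norm_num)]; simp
        _ ≤ 4 * g t := by gcongr; exact ENNReal.ofReal_toReal_le
  set Z := toMeasurable volume {t : ℝ | ¬ pVar (Set.indicator {x : X | t < v x} (fun _ => (1 : ℝ)))
      ≤ h t + 4 * g t} with hZ
  have hZ0 : volume Z = 0 := by rw [hZ, measure_toMeasurable]; exact hae
  have hZm : MeasurableSet Z := measurableSet_toMeasurable _ _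
  refine ⟨fun t => h t + 4 * g t + Z.indicator (fun _ => ⊤) t, ?_, ?_, ?_⟩
  · exact (hhm.add (hgm.const_mul 4)).add (measurable_const.indicator hZm)
  · intro t
    by_cases ht : pVar (Set.indicator {x : X | t < v x} (fun _ => (1 : ℝ))) ≤ h t + 4 * g t
    · exact ht.trans le_self_add
    · have : t ∈ Z := subset_toMeasurable _ _ ht
      simp [this]
  · have hm4 : Measurable (fun t => h t + 4 * g t) := hhm.add (hgm.const_mul 4)
    rw [lintegral_add_left hm4, lintegral_add_left hhm,
      lintegral_const_mul _ hgm, lintegral_indicator_const hZm, hZ0, mul_zero, add_zero]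
    calc _ ≤ 2 * pVar v + 4 * pVar v := by gcongr
      _ = 6 * pVar v := by ring

end final

theorem stmt14 {X : Type*} [MetricSpace X] [CompleteSpace X] [ConnectedSpace X]
    [MeasurableSpace X] [BorelSpace X]
    (h0 : 0 < μH[1] (Set.univ : Set X)) (h1 : μH[1] (Set.univ : Set X) < ⊤)
    (C₀ : ℝ) (hC₀ : 0 < C₀)
    (hdens : ∀ x : X, Filter.liminf
      (fun r : ℝ => μH[1] (Metric.ball x r) / ENNReal.ofReal r) (𝓝[>] 0)
      < ENNReal.ofReal C₀)
    (u : X → ℝ) (hu : VarH (μH[1]) u < ⊤) :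
    upperIntegral (fun t => VarH (μH[1]) (Set.indicator {x : X | t < u x} (fun _ => (1 : ℝ))))
      ≤ ENNReal.ofReal (3 + 4 * C₀) * VarH (μH[1]) u := by
  have hC := C0_ge h0 C₀ hdens
  rw [VarH, ENNReal.mul_iInf_of_ne (by simp; linarith) ENNReal.ofReal_ne_top]
  refine le_iInf fun v => ?_
  rw [ENNReal.mul_iInf' (by simp) (fun h => absurd h (by simp; linarith))]
  refine le_iInf fun hv => ?_
  by_cases hV : pVar v = ⊤
  · rw [hV, ENNReal.mul_top (by simp; linarith)]
    exact le_top
  obtain ⟨G, hG, hle, hint⟩ := main_v v hV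
  have h6 : (6 : ℝ≥0∞) ≤ ENNReal.ofReal (3 + 4 * C₀) := by
    rw [show (6 : ℝ≥0∞) = ENNReal.ofReal 6 by simp]
    exact ENNReal.ofReal_le_ofReal (by linarith)
  refine le_trans ?_ (hint.trans (by gcongr))
  refine iInf_le_of_le G (iInf_le_of_le hG (iInf_le_of_le (fun t => ?_) le_rfl))
  refine le_trans ?_ (hle t)
  refine iInf₂_le _ ?_
  filter_upwards [hv] with x hx
  simp only [Set.indicator_apply, Set.mem_setOf_eq, hx]
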